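/- arXiv:1701.02774 — 3 statements merged into one kernel-verified Lean document; each statement's English description precedes it below -/
import Mathlib

section
/- Let β be a (p,q)-clan, let x be the matrix of S_β with all free entries set to 0, and let I_{p,q} be the diagonal n×n matrix with p diagonal entries 1 followed by q diagonal entries −1. Then x·I_{p,q}·x^{−1}·I_{p,q} is a monomial matrix (exactly one nonzero entry in each row and each column), and its (i,j) entry is nonzero precisely when i = I(β)(j), where I(β) is the underlying involution of β. -/
noncomputable section
open scoped Classical

/-- A `(p,q)`-clan: a partial matching of `{0,…,p+q-1}` (encoded by the involution `mate`)
together with a sign (`true` = `+`, `false` = `-`) at each unmatched position, such that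
`#(+) - #(-) = p - q`.  Matched positions carry the junk sign `true`. -/
structure Clan (p q : ℕ) where
  mate : Fin (p + q) → Fin (p + q)
  mate_invol : ∀ i, mate (mate i) = i
  sign : Fin (p + q) → Bool
  sign_matched : ∀ i, mate i ≠ i → sign i = true
  plus_minus :
    (Finset.univ.filter fun i => mate i = i ∧ sign i = true).card + q
      = (Finset.univ.filter fun i => mate i = i ∧ sign i = false).card + p

namespace Clan

variable {p q r s : ℕ}

/-- position `i` carries a `+`. -/
def IsPlus (c : Clan p q) (i : Fin (p + q)) : Prop :=
  c.mate i = i ∧ c.sign i = true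

/-- position `i` carries a `-`. -/
def IsMinus (c : Clan p q) (i : Fin (p + q)) : Prop :=
  c.mate i = i ∧ c.sign i = false

/-- position `i` is the left end of a matching. -/
def IsLeft (c : Clan p q) (i : Fin (p + q)) : Prop :=
  i < c.mate i

/-- position `i` is the right end of a matching. -/
def IsRight (c : Clan p q) (i : Fin (p + q)) : Prop :=
  c.mate i < i

/-- `(i < j)` is a matching of the clan `c`. -/
def IsMatch (c : Clan p q) (i j : Fin (p + q)) : Prop :=
  i < j ∧ c.mate i = j

/-- The length `ℓ(c)` of a clan:
`ℓ(c) = Σ_{(i<j) matching} (j - i - #{matchings (s<t) with s < i < t < j})`. -/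
def len (c : Clan p q) : ℤ :=
  ∑ ij ∈ Finset.univ.filter (fun ij : Fin (p + q) × Fin (p + q) => c.IsMatch ij.1 ij.2),
    (((ij.2 : ℕ) : ℤ) - ((ij.1 : ℕ) : ℤ) -
      ((Finset.univ.filter (fun st : Fin (p + q) × Fin (p + q) =>
          c.IsMatch st.1 st.2 ∧ st.1 < ij.1 ∧ ij.1 < st.2 ∧ st.2 < ij.2)).card : ℤ))

/-- `c` and `c'` agree (same symbols, same matchings) at every position outside `S`. -/
def AgreeOutside (c c' : Clan p q) (S : Set (Fin (p + q))) : Prop :=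
  ∀ i, i ∉ S → c.mate i = c'.mate i ∧ c.sign i = c'.sign i

/-- `c'` is obtained from `c` by one of the transpositions (T.1)–(T.10). -/
def Transposition (c c' : Clan p q) : Prop :=
  -- (T.1)  +- ↦ 11
  (∃ a b, a < b ∧ c.IsPlus a ∧ c.IsMinus b ∧ c'.IsMatch a b ∧
      AgreeOutside c c' {a, b}) ∨
  -- (T.2)  -+ ↦ 11
  (∃ a b, a < b ∧ c.IsMinus a ∧ c.IsPlus b ∧ c'.IsMatch a b ∧
      AgreeOutside c c' {a, b}) ∨
  -- (T.3)  11+ ↦ 1+1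
  (∃ a b d, c.IsMatch a b ∧ b < d ∧ c.IsPlus d ∧ c'.IsMatch a d ∧ c'.IsPlus b ∧
      AgreeOutside c c' {a, b, d}) ∨
  -- (T.4)  11- ↦ 1-1
  (∃ a b d, c.IsMatch a b ∧ b < d ∧ c.IsMinus d ∧ c'.IsMatch a d ∧ c'.IsMinus b ∧
      AgreeOutside c c' {a, b, d}) ∨
  -- (T.5)  +11 ↦ 1+1
  (∃ a b d, c.IsPlus a ∧ a < b ∧ c.IsMatch b d ∧ c'.IsMatch a d ∧ c'.IsPlus b ∧
      AgreeOutside c c' {a, b, d}) ∨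
  -- (T.6)  -11 ↦ 1-1
  (∃ a b d, c.IsMinus a ∧ a < b ∧ c.IsMatch b d ∧ c'.IsMatch a d ∧ c'.IsMinus b ∧
      AgreeOutside c c' {a, b, d}) ∨
  -- (T.7)  1122 ↦ 1212
  (∃ i j k l, c.IsMatch i j ∧ j < k ∧ c.IsMatch k l ∧ c'.IsMatch i k ∧ c'.IsMatch j l ∧
      AgreeOutside c c' {i, j, k, l}) ∨
  -- (T.8)  1122 ↦ 1+-1
  (∃ i j k l, c.IsMatch i j ∧ j < k ∧ c.IsMatch k l ∧ c'.IsMatch i l ∧ c'.IsPlus j ∧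
      c'.IsMinus k ∧ AgreeOutside c c' {i, j, k, l}) ∨
  -- (T.9)  1122 ↦ 1-+1
  (∃ i j k l, c.IsMatch i j ∧ j < k ∧ c.IsMatch k l ∧ c'.IsMatch i l ∧ c'.IsMinus j ∧
      c'.IsPlus k ∧ AgreeOutside c c' {i, j, k, l}) ∨
  -- (T.10) 1212 ↦ 1221
  (∃ i j k l, i < j ∧ j < k ∧ k < l ∧ c.IsMatch i k ∧ c.IsMatch j l ∧ c'.IsMatch i l ∧
      c'.IsMatch j k ∧ AgreeOutside c c' {i, j, k, l})

/-- Bruhat order `≤` on clans: generated by transpositions. -/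
def ble (c c' : Clan p q) : Prop :=
  Relation.ReflTransGen Transposition c c'

/-- Strict Bruhat order `<` on clans. -/
def blt (c c' : Clan p q) : Prop :=
  Relation.TransGen Transposition c c'

/-- Covering relation: `c ⋖ c'` iff `c < c'` and `ℓ(c') = ℓ(c) + 1`. -/
def Covers (c c' : Clan p q) : Prop :=
  blt c c' ∧ c'.len = c.len + 1

/-- `θ` pattern contains `γ` via the strictly increasing index map `ι`. -/
def Pattern (θ : Clan r s) (γ : Clan p q) (ι : Fin (p + q) → Fin (r + s)) : Prop :=
  StrictMono ι ∧
  (∀ j, γ.mate j = j → θ.mate (ι j) = ι j ∧ θ.sign (ι j) = γ.sign j) ∧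
  (∀ k l, γ.IsMatch k l → θ.IsMatch (ι k) (ι l))

/-- `φ` agrees with `θ` at every position outside the range of `ι`. -/
def AgreesWithOutside (φ θ : Clan r s) (ι : Fin (p + q) → Fin (r + s)) : Prop :=
  ∀ m, (∀ k, ι k ≠ m) → φ.mate m = θ.mate m ∧ φ.sign m = θ.sign m

/-- `[α,γ]` interval pattern embeds into `[β,θ]` via `ι`. -/
def IntervalEmbed (α γ : Clan p q) (β θ : Clan r s)
    (ι : Fin (p + q) → Fin (r + s)) : Prop :=
  Pattern θ γ ι ∧ Pattern β α ι ∧ AgreesWithOutside β θ ι ∧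
  θ.len - β.len = γ.len - α.len

/-- `θ` interval pattern contains `[α,γ]`. -/
def IntervalContains (θ : Clan r s) (α γ : Clan p q) : Prop :=
  ∃ (ι : Fin (p + q) → Fin (r + s)) (φ : Clan r s), IntervalEmbed α γ φ θ ι

/-- `γ(i;+)` (here `i` is the number of initial positions considered, i.e. `i` is 1-indexed):
number of `+`'s plus number of matchings entirely among the first `i` positions. -/
def statPlus (c : Clan p q) (i : ℕ) : ℕ :=
  (Finset.univ.filter fun j : Fin (p + q) => (j : ℕ) < i ∧ c.IsPlus j).card +
  (Finset.univ.filter fun ab : Fin (p + q) × Fin (p + q) =>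
      c.IsMatch ab.1 ab.2 ∧ (ab.2 : ℕ) < i).card

/-- `γ(i;-)`, as in `statPlus` with `-`'s. -/
def statMinus (c : Clan p q) (i : ℕ) : ℕ :=
  (Finset.univ.filter fun j : Fin (p + q) => (j : ℕ) < i ∧ c.IsMinus j).card +
  (Finset.univ.filter fun ab : Fin (p + q) × Fin (p + q) =>
      c.IsMatch ab.1 ab.2 ∧ (ab.2 : ℕ) < i).card

/-- `γ(i;j)` (with `i < j` 1-indexed): number of matchings with left endpoint weakly left
of `i` and right endpoint strictly right of `j`. -/
def statMid (c : Clan p q) (i j : ℕ) : ℕ :=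
  (Finset.univ.filter fun ab : Fin (p + q) × Fin (p + q) =>
      c.IsMatch ab.1 ab.2 ∧ (ab.1 : ℕ) < i ∧ j ≤ (ab.2 : ℕ)).card

/-- The permutation `w_c` associated to a clan `c`, 0-indexed: positions carrying a `+` or a
left endpoint get (in left-to-right order) the values `0,…,p-1`; the remaining values
`p,…,p+q-1` are assigned, scanning left to right, to each `-` as it is encountered and to the
right end of each matching as soon as its left end is encountered. -/
def wNat (c : Clan p q) (i : Fin (p + q)) : ℕ :=
  if c.IsPlus i ∨ c.IsLeft i then
    (Finset.univ.filter fun j : Fin (p + q) => (c.IsPlus j ∨ c.IsLeft j) ∧ j < i).card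
  else
    p + (Finset.univ.filter fun j : Fin (p + q) =>
        (c.IsMinus j ∨ c.IsLeft j) ∧ j < (if c.IsMinus i then i else c.mate i)).card

/-- Membership in the affine space `S_c`: the conditions (O.1)–(O.3) and (Z.1)–(Z.9). -/
def MemS (c : Clan p q) (M : Matrix (Fin (p + q)) (Fin (p + q)) ℂ) : Prop :=
  -- (O.1)
  (∀ i j : Fin (p + q), c.mate i = i → (j : ℕ) = c.wNat i → M i j = 1) ∧
  -- (O.2)
  (∀ i i' j : Fin (p + q), c.IsMatch i i' →
      ((j : ℕ) = c.wNat i ∨ (j : ℕ) = c.wNat i') → M i j = 1) ∧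
  -- (O.3)
  (∀ i i' j : Fin (p + q), c.IsMatch i i' → (j : ℕ) = c.wNat i → M i' j = -1) ∧
  (∀ i i' j : Fin (p + q), c.IsMatch i i' → (j : ℕ) = c.wNat i' → M i' j = 1) ∧
  -- (Z.1): first p columns, rows containing a pivot (rows of +'s and of left endpoints)
  (∀ i j : Fin (p + q), (c.IsPlus i ∨ c.IsLeft i) → (j : ℕ) < p →
      (j : ℕ) ≠ c.wNat i → M i j = 0) ∧
  -- (Z.2): above a pivot, first p columns
  (∀ i x j : Fin (p + q), (c.IsPlus i ∨ c.IsLeft i) → (j : ℕ) = c.wNat i →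
      x < i → M x j = 0) ∧
  -- (Z.3): between the pivot 1 and the -1 of a column
  (∀ i i' x j : Fin (p + q), c.IsMatch i i' → (j : ℕ) = c.wNat i →
      i < x → x < i' → M x j = 0) ∧
  -- (Z.4): right of a -1, within the first p columns
  (∀ i i' j : Fin (p + q), c.IsMatch i i' → c.wNat i < (j : ℕ) → (j : ℕ) < p →
      M i' j = 0) ∧
  -- (Z.5): last q columns, rows containing a pivot (rows of -'s and of left endpoints)
  (∀ i j : Fin (p + q), c.IsMinus i → p ≤ (j : ℕ) → (j : ℕ) ≠ c.wNat i → M i j = 0) ∧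
  (∀ i i' j : Fin (p + q), c.IsMatch i i' → p ≤ (j : ℕ) → (j : ℕ) ≠ c.wNat i' →
      M i j = 0) ∧
  -- (Z.6): above a pivot, last q columns
  (∀ i x j : Fin (p + q), c.IsMinus i → (j : ℕ) = c.wNat i → x < i → M x j = 0) ∧
  (∀ i i' x j : Fin (p + q), c.IsMatch i i' → (j : ℕ) = c.wNat i' → x < i → M x j = 0) ∧
  -- (Z.7): between the pivot 1 and the second 1 of a column
  (∀ i i' x j : Fin (p + q), c.IsMatch i i' → (j : ℕ) = c.wNat i' →
      i < x → x < i' → M x j = 0) ∧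
  -- (Z.8): right of a second-1-of-its-column
  (∀ i i' j : Fin (p + q), c.IsMatch i i' → c.wNat i' < (j : ℕ) → M i' j = 0) ∧
  -- (Z.9): identification for 1212 patterns
  (∀ i j k l ci ck : Fin (p + q), c.IsMatch i k → c.IsMatch j l →
      i < j → j < k → k < l → (ci : ℕ) = c.wNat i → (ck : ℕ) = c.wNat k →
      M l ck = - M l ci)

/-- Rank of the southwest `(n-i) × p` submatrix of `M` (`i` 1-indexed from `1` to `n`). -/
def swRank (p q : ℕ) (M : Matrix (Fin (p + q)) (Fin (p + q)) ℂ) (i : ℕ) : ℕ :=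
  Matrix.rank (Matrix.of fun (x : Fin (p + q - i)) (y : Fin p) =>
    M ⟨i + (x : ℕ), by have := x.isLt; omega⟩ ⟨(y : ℕ), by have := y.isLt; omega⟩)

/-- Rank of the southeast `(n-i) × q` submatrix of `M`. -/
def seRank (p q : ℕ) (M : Matrix (Fin (p + q)) (Fin (p + q)) ℂ) (i : ℕ) : ℕ :=
  Matrix.rank (Matrix.of fun (x : Fin (p + q - i)) (y : Fin q) =>
    M ⟨i + (x : ℕ), by have := x.isLt; omega⟩ ⟨p + (y : ℕ), by have := y.isLt; omega⟩)

/-- Rank of the auxiliary matrix `M^{[i;j]}`: its first `i` columns are the first `i` columns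
of `M⁻¹` with the last `q` rows zeroed out, its last `j` columns are the first `j` columns
of `M⁻¹`. -/
def auxRank (p q : ℕ) (M : Matrix (Fin (p + q)) (Fin (p + q)) ℂ) (i j : ℕ) : ℕ :=
  Matrix.rank (Matrix.of fun (x : Fin (p + q)) (y : Fin i ⊕ Fin j) =>
    Sum.elim
      (fun a : Fin i =>
        if p ≤ (x : ℕ) then (0 : ℂ)
        else if h : (a : ℕ) < p + q then M⁻¹ x ⟨(a : ℕ), h⟩ else 0)
      (fun b : Fin j =>
        if h : (b : ℕ) < p + q then M⁻¹ x ⟨(b : ℕ), h⟩ else 0) y)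

/-- The Mars–Springer variety `N_{θ,c}`: matrices of `S_c` satisfying the rank
conditions (R.1)–(R.3) attached to `θ`. -/
def MarsSpringer (θ c : Clan p q) (M : Matrix (Fin (p + q)) (Fin (p + q)) ℂ) : Prop :=
  MemS c M ∧
  (∀ i : ℕ, 1 ≤ i → i ≤ p + q → swRank p q M i ≤ p - statPlus θ i) ∧
  (∀ i : ℕ, 1 ≤ i → i ≤ p + q → seRank p q M i ≤ q - statMinus θ i) ∧
  (∀ i j : ℕ, 1 ≤ i → i < j → j ≤ p + q → auxRank p q M i j ≤ j + statMid θ i j)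

/-- The linear relations defining the coordinates `λ_{k,a}`:
`e_k + Σ_{a ≥ p} λ_{k,a} v_a = Σ_{a < p} λ_{k,a} v_a`, where `v_a` are the columns of `M`. -/
def LambdaRel (p q : ℕ) (M : Matrix (Fin (p + q)) (Fin (p + q)) ℂ)
    (lam : Fin (p + q) → Fin (p + q) → ℂ) : Prop :=
  ∀ k x : Fin (p + q),
    (if x = k then (1 : ℂ) else 0) +
        ∑ a ∈ Finset.univ.filter (fun a : Fin (p + q) => p ≤ (a : ℕ)), lam k a * M x a
      = ∑ a ∈ Finset.univ.filter (fun a : Fin (p + q) => (a : ℕ) < p), lam k a * M x a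

/-- The base point of `S_c`: all free entries set to `0`. -/
def basePoint (c : Clan p q) : Matrix (Fin (p + q)) (Fin (p + q)) ℂ :=
  Matrix.of fun i j =>
    if (j : ℕ) = c.wNat i then 1
    else if c.mate i ≠ i ∧ (j : ℕ) = c.wNat (c.mate i) then
      (if c.mate i < i then -1 else 1)
    else 0

/-- The diagonal matrix `I_{p,q}` with `p` ones followed by `q` negative ones. -/
def Ipq (p q : ℕ) : Matrix (Fin (p + q)) (Fin (p + q)) ℂ :=
  Matrix.diagonal fun i => if (i : ℕ) < p then 1 else -1

end Clan

/-- The matrix `x · I_{p,q} · x⁻¹ · I_{p,q}` where `x` is the base point of `S_β`. -/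
def conjMat {p q : ℕ} (β : Clan p q) : Matrix (Fin (p + q)) (Fin (p + q)) ℂ :=
  Clan.basePoint β * Clan.Ipq p q * (Clan.basePoint β)⁻¹ * Clan.Ipq p q

namespace Clan

variable {p q : ℕ}

lemma mate_injective (c : Clan p q) : Function.Injective c.mate :=
  Function.LeftInverse.injective c.mate_invol

lemma card_isLeft_eq_card_isRight (c : Clan p q) :
    (Finset.univ.filter fun i => c.IsLeft i).card
      = (Finset.univ.filter fun i => c.IsRight i).card :=
  Finset.card_bij' (fun i _ => c.mate i) (fun i _ => c.mate i)
    (fun i => by simp only [Finset.mem_filter_univ]; simp [IsLeft, IsRight, c.mate_invol])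
    (fun i => by simp only [Finset.mem_filter_univ]; simp [IsLeft, IsRight, c.mate_invol])
    (by simp [c.mate_invol]) (by simp [c.mate_invol])

lemma card_isPlus_add (c : Clan p q) :
    (Finset.univ.filter fun i => c.IsPlus i).card + q
      = (Finset.univ.filter fun i => c.IsMinus i).card + p := by
  convert c.plus_minus <;> rfl

lemma card_symbols (c : Clan p q) :
    (Finset.univ.filter fun i => c.IsPlus i).card
      + (Finset.univ.filter fun i => c.IsMinus i).card
      + (Finset.univ.filter fun i => c.IsLeft i).card
      + (Finset.univ.filter fun i => c.IsRight i).card = p + q := by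
  simp only [Finset.card_filter, ← Finset.sum_add_distrib]
  rw [Finset.sum_congr rfl (g := fun _ => 1), Finset.sum_const, Finset.card_univ, Fintype.card_fin,
    smul_eq_mul, mul_one]
  intro i _
  rcases lt_trichotomy i (c.mate i) with h | h | h
  · simp [IsPlus, IsMinus, IsLeft, IsRight, h, h.not_gt, h.ne']
  · cases hs : c.sign i <;> simp [IsPlus, IsMinus, IsLeft, IsRight, ← h, hs]
  · simp [IsPlus, IsMinus, IsLeft, IsRight, h, h.not_gt, h.ne]

lemma card_isPlus_or_isLeft (c : Clan p q) :
    (Finset.univ.filter fun i => c.IsPlus i ∨ c.IsLeft i).card = p := by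
  have hd : Disjoint (Finset.univ.filter fun i => c.IsPlus i)
      (Finset.univ.filter fun i => c.IsLeft i) :=
    Finset.disjoint_filter.2 fun i _ h h' => h'.ne h.1.symm
  have h := c.card_isPlus_add
  have h1 := c.card_symbols
  have h2 := c.card_isLeft_eq_card_isRight
  rw [Finset.filter_or, Finset.card_union_of_disjoint hd]
  omega

lemma card_isMinus_or_isLeft (c : Clan p q) :
    (Finset.univ.filter fun i => c.IsMinus i ∨ c.IsLeft i).card = q := by
  have hd : Disjoint (Finset.univ.filter fun i => c.IsMinus i)
      (Finset.univ.filter fun i => c.IsLeft i) :=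
    Finset.disjoint_filter.2 fun i _ h h' => h'.ne h.1.symm
  have h := c.card_isPlus_add
  have h1 := c.card_symbols
  have h2 := c.card_isLeft_eq_card_isRight
  rw [Finset.filter_or, Finset.card_union_of_disjoint hd]
  omega

lemma card_filter_and_lt_lt {n : ℕ} (P : Fin n → Prop) [DecidablePred P] {i j : Fin n}
    (hi : P i) (hij : i < j) :
    (Finset.univ.filter fun k => P k ∧ k < i).card
      < (Finset.univ.filter fun k => P k ∧ k < j).card := by
  refine Finset.card_lt_card (Finset.ssubset_iff_of_subset ?_ |>.2 ⟨i, by simp [hi, hij], by simp⟩)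
  exact Finset.monotone_filter_right _ fun k _ h => ⟨h.1, h.2.trans hij⟩

lemma card_filter_and_lt_injOn {n : ℕ} (P : Fin n → Prop) [DecidablePred P] :
    Set.InjOn (fun i => (Finset.univ.filter fun k => P k ∧ k < i).card) {i | P i} := by
  intro i hi j hj h
  rcases lt_trichotomy i j with hij | hij | hij
  · exact absurd h (card_filter_and_lt_lt P hi hij).ne
  · exact hij
  · exact absurd h (card_filter_and_lt_lt P hj hij).ne'

lemma card_filter_and_lt_lt_card {n : ℕ} (P : Fin n → Prop) [DecidablePred P] {i : Fin n}
    (hi : P i) :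
    (Finset.univ.filter fun k => P k ∧ k < i).card < (Finset.univ.filter P).card := by
  refine Finset.card_lt_card (Finset.ssubset_iff_of_subset ?_ |>.2 ⟨i, by simp [hi], by simp⟩)
  exact Finset.monotone_filter_right _ fun k _ h => h.1

/-- The position whose scanning assigns the value of `w_c` at `i`, when that value is among the
last `q`. -/
def source (c : Clan p q) (i : Fin (p + q)) : Fin (p + q) :=
  if c.IsMinus i then i else c.mate i

lemma source_spec (c : Clan p q) {i : Fin (p + q)} (h : ¬ (c.IsPlus i ∨ c.IsLeft i)) :
    c.IsMinus (c.source i) ∨ c.IsLeft (c.source i) := by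
  unfold source
  split_ifs with hm
  · exact Or.inl hm
  · right
    simp only [IsPlus, IsLeft, IsMinus, not_or, not_and, not_lt, Bool.not_eq_true,
      Bool.not_eq_false, c.mate_invol] at *
    exact lt_of_le_of_ne h.2 fun e => by simp [h.1 e] at hm; exact hm e

lemma source_injOn (c : Clan p q) :
    Set.InjOn c.source {i | ¬ (c.IsPlus i ∨ c.IsLeft i)} := by
  intro i _ j _ h
  unfold source at h
  split_ifs at h with h1 h2 h2
  · exact h
  · rw [← h1.1] at h; exact c.mate_injective h
  · rw [← h2.1] at h; exact c.mate_injective h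
  · exact c.mate_injective h

lemma wNat_of_isPlus_or_isLeft (c : Clan p q) {i : Fin (p + q)} (h : c.IsPlus i ∨ c.IsLeft i) :
    c.wNat i = (Finset.univ.filter fun j => (c.IsPlus j ∨ c.IsLeft j) ∧ j < i).card :=
  if_pos h

lemma wNat_of_not (c : Clan p q) {i : Fin (p + q)} (h : ¬ (c.IsPlus i ∨ c.IsLeft i)) :
    c.wNat i
      = p + (Finset.univ.filter fun j => (c.IsMinus j ∨ c.IsLeft j) ∧ j < c.source i).card :=
  if_neg h

lemma wNat_lt_left_iff (c : Clan p q) (i : Fin (p + q)) :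
    c.wNat i < p ↔ c.IsPlus i ∨ c.IsLeft i := by
  refine ⟨fun h => ?_, fun h => ?_⟩
  · by_contra hn
    rw [c.wNat_of_not hn] at h
    omega
  · rw [c.wNat_of_isPlus_or_isLeft h]
    exact (card_filter_and_lt_lt_card _ h).trans_eq c.card_isPlus_or_isLeft

lemma wNat_lt (c : Clan p q) (i : Fin (p + q)) : c.wNat i < p + q := by
  by_cases h : c.IsPlus i ∨ c.IsLeft i
  · have := (c.wNat_lt_left_iff i).2 h
    omega
  · rw [c.wNat_of_not h]
    exact Nat.add_lt_add_left
      ((card_filter_and_lt_lt_card _ (c.source_spec h)).trans_eq c.card_isMinus_or_isLeft) p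

lemma wNat_injective (c : Clan p q) : Function.Injective c.wNat := by
  intro i j h
  by_cases hi : c.IsPlus i ∨ c.IsLeft i
  · have hj := (c.wNat_lt_left_iff j).1 (h ▸ (c.wNat_lt_left_iff i).2 hi)
    rw [c.wNat_of_isPlus_or_isLeft hi, c.wNat_of_isPlus_or_isLeft hj] at h
    exact card_filter_and_lt_injOn (fun k => c.IsPlus k ∨ c.IsLeft k) hi hj h
  · have hj : ¬ (c.IsPlus j ∨ c.IsLeft j) := fun hj =>
      hi ((c.wNat_lt_left_iff i).1 (h ▸ (c.wNat_lt_left_iff j).2 hj))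
    rw [c.wNat_of_not hi, c.wNat_of_not hj] at h
    exact c.source_injOn hi hj (card_filter_and_lt_injOn (fun k => c.IsMinus k ∨ c.IsLeft k)
      (c.source_spec hi) (c.source_spec hj) (Nat.add_left_cancel h))

/-- The permutation `w_c`. -/
def wPerm (c : Clan p q) : Equiv.Perm (Fin (p + q)) :=
  Equiv.ofBijective (fun i => ⟨c.wNat i, c.wNat_lt i⟩) <| Finite.injective_iff_bijective.1
    fun _ _ h => c.wNat_injective (Fin.ext_iff.1 h)

@[simp]
lemma wPerm_val (c : Clan p q) (i : Fin (p + q)) : (c.wPerm i : ℕ) = c.wNat i := rfl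

lemma basePoint_wPerm (c : Clan p q) (i k : Fin (p + q)) :
    c.basePoint i (c.wPerm k)
      = if k = i then 1 else if k = c.mate i then (if c.mate i < i then -1 else 1) else 0 := by
  simp only [basePoint, Matrix.of_apply, wPerm_val, c.wNat_injective.eq_iff]
  split_ifs <;> grind

lemma basePoint_mulVec (c : Clan p q) (v : Fin (p + q) → ℂ) (i : Fin (p + q)) :
    (c.basePoint.mulVec v) i = v (c.wPerm i)
      + if c.mate i = i then 0 else (if c.mate i < i then -1 else 1) * v (c.wPerm (c.mate i)) := by
  rw [Matrix.mulVec, dotProduct, ← Equiv.sum_comp c.wPerm]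
  simp only [basePoint_wPerm]
  have (k : Fin (p + q)) :
      (if k = i then (1 : ℂ) else if k = c.mate i then (if c.mate i < i then -1 else 1) else 0)
          * v (c.wPerm k)
        = (if k = i then v (c.wPerm k) else 0) + (if k = c.mate i then
            (if c.mate i = i then 0 else (if c.mate i < i then -1 else 1) * v (c.wPerm k))
            else 0) := by
    split_ifs <;> grind
  simp [this, Finset.sum_add_distrib]

lemma isUnit_basePoint (c : Clan p q) : IsUnit c.basePoint := by
  rw [← Matrix.mulVec_injective_iff_isUnit]
  refine (injective_iff_map_eq_zero c.basePoint.mulVecLin).2 fun v hv => ?_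
  ext a
  obtain ⟨i, rfl⟩ := c.wPerm.surjective a
  have h (k : Fin (p + q)) := (c.basePoint_mulVec v k).symm.trans (congrFun hv k)
  have h1 := h i
  have h2 := h (c.mate i)
  simp only [c.mate_invol, Pi.zero_apply] at h1 h2 ⊢
  rcases lt_trichotomy i (c.mate i) with hi | hi | hi
  · simp only [hi, hi.ne, hi.ne', hi.not_gt, if_true, if_false] at h1 h2
    linear_combination (h1 - h2) / 2
  · simpa [← hi] using h1
  · simp only [hi, hi.ne, hi.ne', hi.not_gt, if_true, if_false] at h1 h2
    linear_combination (h1 + h2) / 2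

/-- The signed permutation matrix of the underlying involution of `c`: its nonzero entries are the
signs of `c` on the diagonal and `-1` at the matchings. -/
def signedInvolution (c : Clan p q) : Matrix (Fin (p + q)) (Fin (p + q)) ℂ :=
  Matrix.of fun i j => if j = c.mate i then (if c.IsPlus i then 1 else -1) else 0

lemma signedInvolution_mul_basePoint (c : Clan p q) :
    c.signedInvolution * c.basePoint = c.basePoint * Ipq p q := by
  ext i a
  obtain ⟨k, rfl⟩ := c.wPerm.surjective a
  rw [Matrix.mul_apply, Ipq, Matrix.mul_diagonal]
  simp only [signedInvolution, Matrix.of_apply, ite_mul, zero_mul, Finset.sum_ite_eq',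
    Finset.mem_univ, if_true, wPerm_val, wNat_lt_left_iff, basePoint_wPerm, c.mate_invol,
    IsPlus, IsLeft]
  rcases lt_trichotomy i (c.mate i) with hi | hi | hi
  · by_cases h1 : k = i
    · subst h1; simp [hi, hi.ne, hi.ne']
    · by_cases h2 : k = c.mate i
      · subst h2; simp [hi.ne, hi.ne', hi.not_gt, c.mate_invol]
      · simp [h1, h2]
  · by_cases h1 : k = i
    · subst h1; simp [← hi]
    · simp [← hi, h1]
  · by_cases h1 : k = i
    · subst h1; simp [hi.ne, hi.ne', hi.not_gt]
    · by_cases h2 : k = c.mate i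
      · subst h2; simp [hi, hi.ne, hi.ne', c.mate_invol]
      · simp [h1, h2]

end Clan

lemma conjMat_eq {p q : ℕ} (β : Clan p q) :
    conjMat β = β.signedInvolution * Clan.Ipq p q := by
  rw [conjMat, ← β.signedInvolution_mul_basePoint,
    Matrix.mul_nonsing_inv_cancel_right _ _ ((Matrix.isUnit_iff_isUnit_det _).1 β.isUnit_basePoint)]

lemma conjMat_ne_zero_iff {p q : ℕ} (β : Clan p q) (i j : Fin (p + q)) :
    conjMat β i j ≠ 0 ↔ i = β.mate j := by
  have : j = β.mate i ↔ i = β.mate j :=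
    ⟨fun h => by rw [h, β.mate_invol], fun h => by rw [h, β.mate_invol]⟩
  rw [conjMat_eq, Clan.Ipq, Matrix.mul_diagonal, ← this, Clan.signedInvolution, Matrix.of_apply]
  by_cases h : j = β.mate i
  · simp only [h, if_true, iff_true]
    split_ifs <;> simp
  · simp [h]

/-- `x I_{p,q} x⁻¹ I_{p,q}` is a monomial matrix, whose `(i,j)` entry is
nonzero precisely when `i = I(β)(j)` (the underlying involution of `β`). -/
theorem base_point_conjugate_is_monomial {p q : ℕ} (β : Clan p q) :
    (∀ j : Fin (p + q), ∃! i : Fin (p + q), conjMat β i j ≠ 0) ∧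
    (∀ i : Fin (p + q), ∃! j : Fin (p + q), conjMat β i j ≠ 0) ∧
    (∀ i j : Fin (p + q), conjMat β i j ≠ 0 ↔ i = β.mate j) := by
  refine ⟨fun j => ?_, fun i => ?_, conjMat_ne_zero_iff β⟩
  · simp only [conjMat_ne_zero_iff]
    exact existsUnique_eq
  · simp only [conjMat_ne_zero_iff]
    exact ⟨β.mate i, (β.mate_invol i).symm, fun j h => by rw [h, β.mate_invol]⟩
end
end

section
/- Let β be a (p,q)-clan, M ∈ S_β (such M is invertible), w = w_β, I = I(β), and let λ_{k,a} be the coordinates determined by M as in the context. If β_k is a +, a −, or the left end of a matching, then λ_{k,w(b)} = λ_{k,w(I(b))} = 0 for every b < k. If β_k is the right end of a matching, then λ_{k,w(b)} = λ_{k,w(I(b))} = 0 for every b < I(k). -/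
noncomputable section
open scoped Classical

namespace Clan

lemma card_filter_lt_strictMono {n : ℕ} {P : Fin n → Prop} [DecidablePred P] {x y : Fin n}
    (hx : P x) (hxy : x < y) : (Finset.univ.filter fun j => P j ∧ j < x).card
      < (Finset.univ.filter fun j => P j ∧ j < y).card :=
  Finset.card_lt_card <| Finset.ssubset_iff_subset_ne.2
    ⟨fun j hj => by
      simp only [Finset.mem_filter, Finset.mem_univ, true_and] at hj ⊢
      exact ⟨hj.1, hj.2.trans hxy⟩, fun h => by
      have : x ∈ Finset.univ.filter fun j => P j ∧ j < y := by simp [hx, hxy]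
      rw [← h] at this
      simp at this⟩

lemma card_filter_lt_lt_card_filter {n : ℕ} {P : Fin n → Prop} [DecidablePred P] {x : Fin n}
    (hx : P x) : (Finset.univ.filter fun j => P j ∧ j < x).card
      < (Finset.univ.filter P).card :=
  Finset.card_lt_card <| Finset.ssubset_iff_subset_ne.2
    ⟨fun j hj => by simp_all, fun h => by
      have : x ∈ Finset.univ.filter P := by simpa using hx
      rw [← h] at this
      simp at this⟩

/-- The number of elements of `P` strictly below `y`, for `y` in `P`, takes each value less than
the number of elements of `P`. -/
lemma exists_card_filter_lt_eq {n : ℕ} (P : Fin n → Prop) [DecidablePred P] {a : ℕ}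
    (ha : a < (Finset.univ.filter P).card) :
    ∃ y, P y ∧ (Finset.univ.filter fun j => P j ∧ j < y).card = a := by
  have hsurj : Set.SurjOn (fun y => (Finset.univ.filter fun j => P j ∧ j < y).card)
      (Finset.univ.filter P : Finset (Fin n)) (Finset.range (Finset.univ.filter P).card) := by
    apply Finset.surjOn_of_injOn_of_card_le
    · intro y hy
      simpa using card_filter_lt_lt_card_filter (by simpa using hy)
    · intro x hx y hy hxy
      rw [Finset.mem_coe, Finset.mem_filter] at hx hy
      rcases lt_trichotomy x y with h | h | h
      · exact absurd hxy (card_filter_lt_strictMono hx.2 h).ne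
      · exact h
      · exact absurd hxy (card_filter_lt_strictMono hy.2 h).ne'
    · simp
  obtain ⟨y, hy, hya⟩ := hsurj (by simpa using ha : a ∈ _)
  exact ⟨y, by simpa using hy, hya⟩

variable {p q : ℕ} (c : Clan p q)

lemma card_isRight :
    (Finset.univ.filter c.IsRight).card = (Finset.univ.filter c.IsLeft).card := by
  refine Finset.card_bij' (fun i _ => c.mate i) (fun i _ => c.mate i) ?_ ?_ ?_ ?_ <;>
    simp [IsRight, IsLeft, c.mate_invol]

lemma card_isPlus_or_isLeft_and_card_isMinus_or_isLeft :
    (Finset.univ.filter fun i => c.IsPlus i ∨ c.IsLeft i).card = p ∧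
      (Finset.univ.filter fun i => c.IsMinus i ∨ c.IsLeft i).card = q := by
  have hP : (Finset.univ.filter fun i => c.IsPlus i ∨ c.IsLeft i).card
      = (Finset.univ.filter c.IsPlus).card + (Finset.univ.filter c.IsLeft).card := by
    rw [Finset.filter_or, Finset.card_union_of_disjoint]
    exact Finset.disjoint_filter.2 fun i _ h h' => h'.ne' h.1
  have hN : (Finset.univ.filter fun i => c.IsMinus i ∨ c.IsLeft i).card
      = (Finset.univ.filter c.IsMinus).card + (Finset.univ.filter c.IsLeft).card := by
    rw [Finset.filter_or, Finset.card_union_of_disjoint]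
    exact Finset.disjoint_filter.2 fun i _ h h' => h'.ne' h.1
  have hNR : (Finset.univ.filter fun i => c.IsMinus i ∨ c.IsRight i).card
      = (Finset.univ.filter c.IsMinus).card + (Finset.univ.filter c.IsRight).card := by
    rw [Finset.filter_or, Finset.card_union_of_disjoint]
    exact Finset.disjoint_filter.2 fun i _ h h' => h'.ne h.1
  have hcompl : (Finset.univ.filter fun i => ¬ (c.IsPlus i ∨ c.IsLeft i))
      = Finset.univ.filter fun i => c.IsMinus i ∨ c.IsRight i := by
    refine Finset.filter_congr fun i _ => ?_
    simp only [IsPlus, IsMinus, IsLeft, IsRight]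
    rcases lt_trichotomy (c.mate i) i with h | h | h
    · simp [h, h.ne, h.le]
    · simp [h]
    · simp [h, h.ne', h.le]
  have htot := Finset.card_filter_add_card_filter_not
    (s := (Finset.univ : Finset (Fin (p + q)))) (fun i => c.IsPlus i ∨ c.IsLeft i)
  rw [hcompl, hNR, hP, c.card_isRight, Finset.card_univ, Fintype.card_fin] at htot
  have hpm : (Finset.univ.filter c.IsPlus).card + q = (Finset.univ.filter c.IsMinus).card + p := by
    convert c.plus_minus using 3 <;> ext i <;> rw [Finset.mem_filter, Finset.mem_filter] <;> rfl
  omega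

variable {c} {b y : Fin (p + q)}

lemma wNat_eq_of_isPlus_or_isLeft (h : c.IsPlus b ∨ c.IsLeft b) :
    c.wNat b = (Finset.univ.filter fun j => (c.IsPlus j ∨ c.IsLeft j) ∧ j < b).card :=
  if_pos h

lemma wNat_eq_of_isMinus (h : c.IsMinus b) :
    c.wNat b = p + (Finset.univ.filter fun j => (c.IsMinus j ∨ c.IsLeft j) ∧ j < b).card := by
  have h' : ¬ (c.IsPlus b ∨ c.IsLeft b) := by
    rintro (h' | h')
    · exact absurd (h.2.symm.trans h'.2) (by simp)
    · exact h'.ne' h.1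
  rw [wNat, if_neg h', if_pos h]

lemma wNat_mate_eq_of_isLeft (h : c.IsLeft b) :
    c.wNat (c.mate b)
      = p + (Finset.univ.filter fun j => (c.IsMinus j ∨ c.IsLeft j) ∧ j < b).card := by
  have h₁ : ¬ (c.IsPlus (c.mate b) ∨ c.IsLeft (c.mate b)) := by
    simp only [IsPlus, IsLeft, c.mate_invol]
    rintro (h' | h')
    · exact h.ne h'.1
    · exact h.not_gt h'
  have h₂ : ¬ c.IsMinus (c.mate b) := by
    simp only [IsMinus, c.mate_invol]
    exact fun h' => h.ne h'.1
  rw [wNat, if_neg h₁, if_neg h₂, c.mate_invol]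

lemma wNat_lt_of_isPlus_or_isLeft (h : c.IsPlus b ∨ c.IsLeft b) : c.wNat b < p := by
  rw [wNat_eq_of_isPlus_or_isLeft h]
  exact (card_filter_lt_lt_card_filter h).trans_eq
    c.card_isPlus_or_isLeft_and_card_isMinus_or_isLeft.1

lemma wNat_mate_lt_of_isLeft (h : c.IsLeft b) : c.wNat (c.mate b) < p + q := by
  rw [wNat_mate_eq_of_isLeft h]
  exact Nat.add_lt_add_left ((card_filter_lt_lt_card_filter (Or.inr h)).trans_eq
    c.card_isPlus_or_isLeft_and_card_isMinus_or_isLeft.2) p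

/-- Every column has a pivot row. -/
lemma exists_pivot (c : Clan p q) (a : Fin (p + q)) :
    ∃ y, ((c.IsPlus y ∨ c.IsLeft y) ∧ (a : ℕ) = c.wNat y) ∨
      (c.IsMinus y ∧ (a : ℕ) = c.wNat y) ∨ (c.IsLeft y ∧ (a : ℕ) = c.wNat (c.mate y)) := by
  obtain ⟨hp, hq⟩ := c.card_isPlus_or_isLeft_and_card_isMinus_or_isLeft
  by_cases ha : (a : ℕ) < p
  · obtain ⟨y, hy, hya⟩ := exists_card_filter_lt_eq _ (ha.trans_eq hp.symm)
    exact ⟨y, Or.inl ⟨hy, by rw [wNat_eq_of_isPlus_or_isLeft hy, hya]⟩⟩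
  · have ha' : (a : ℕ) - p < q := by omega
    obtain ⟨y, hy, hya⟩ := exists_card_filter_lt_eq _ (ha'.trans_eq hq.symm)
    refine ⟨y, Or.inr ?_⟩
    rcases hy with h | h
    · exact Or.inl ⟨h, by rw [wNat_eq_of_isMinus h, hya]; omega⟩
    · exact Or.inr ⟨h, by rw [wNat_mate_eq_of_isLeft h, hya]; omega⟩

variable {M : Matrix (Fin (p + q)) (Fin (p + q)) ℂ} {a : Fin (p + q)}

lemma MemS.eq_zero_of_lt_pivot (hM : MemS c M)
    (hy : ((c.IsPlus y ∨ c.IsLeft y) ∧ (a : ℕ) = c.wNat y) ∨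
      (c.IsMinus y ∧ (a : ℕ) = c.wNat y) ∨ (c.IsLeft y ∧ (a : ℕ) = c.wNat (c.mate y)))
    (hby : b < y) : M b a = 0 := by
  obtain ⟨-, -, -, -, -, z2, -, -, -, -, z6, z6', -⟩ := hM
  rcases hy with ⟨h, ha⟩ | ⟨h, ha⟩ | ⟨h, ha⟩
  · exact z2 y b a h ha hby
  · exact z6 y b a h ha hby
  · exact z6' y (c.mate y) b a ⟨h, rfl⟩ ha hby

lemma MemS.mate_eq_zero_of_lt_pivot (hM : MemS c M) (hb : c.IsLeft b)
    (hy : ((c.IsPlus y ∨ c.IsLeft y) ∧ (a : ℕ) = c.wNat y) ∨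
      (c.IsMinus y ∧ (a : ℕ) = c.wNat y) ∨ (c.IsLeft y ∧ (a : ℕ) = c.wNat (c.mate y)))
    (hby : b < y) : M (c.mate b) a = 0 := by
  obtain ⟨-, -, -, -, -, -, -, z4, -, -, -, -, -, z8, -⟩ := hM
  rcases hy with ⟨h, ha⟩ | ⟨h, ha⟩ | ⟨h, ha⟩
  · refine z4 b _ a ⟨hb, rfl⟩ ?_ (ha ▸ wNat_lt_of_isPlus_or_isLeft h)
    rw [ha, wNat_eq_of_isPlus_or_isLeft h, wNat_eq_of_isPlus_or_isLeft (Or.inr hb)]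
    exact card_filter_lt_strictMono (P := fun j => c.IsPlus j ∨ c.IsLeft j) (Or.inr hb) hby
  · refine z8 b _ a ⟨hb, rfl⟩ ?_
    rw [ha, wNat_eq_of_isMinus h, wNat_mate_eq_of_isLeft hb]
    exact Nat.add_lt_add_left (card_filter_lt_strictMono
      (P := fun j => c.IsMinus j ∨ c.IsLeft j) (Or.inr hb) hby) p
  · refine z8 b _ a ⟨hb, rfl⟩ ?_
    rw [ha, wNat_mate_eq_of_isLeft h, wNat_mate_eq_of_isLeft hb]
    exact Nat.add_lt_add_left (card_filter_lt_strictMono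
      (P := fun j => c.IsMinus j ∨ c.IsLeft j) (Or.inr hb) hby) p

/-- The coefficients expressing `e_k` in the columns of `M` vanish on every column whose pivot
row lies above both `k` and its mate. -/
lemma MemS.coeff_eq_zero (hM : MemS c M) {k : Fin (p + q)} {v : Fin (p + q) → ℂ}
    (hv : ∀ x, ∑ a, v a * M x a = if x = k then 1 else 0) (b : Fin (p + q)) :
    b < k → b < c.mate k → b ≤ c.mate b →
      ∀ a : Fin (p + q), ((a : ℕ) = c.wNat b ∨ (a : ℕ) = c.wNat (c.mate b)) → v a = 0 := by
  induction b using WellFoundedLT.induction with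
  | ind b ih =>
  intro hbk hbm hb
  have hsmall : ∀ {a y : Fin (p + q)}, ((c.IsPlus y ∨ c.IsLeft y) ∧ (a : ℕ) = c.wNat y) ∨
      (c.IsMinus y ∧ (a : ℕ) = c.wNat y) ∨ (c.IsLeft y ∧ (a : ℕ) = c.wNat (c.mate y)) →
      y < b → v a = 0 := by
    rintro a y hy hyb
    refine ih y hyb (hyb.trans hbk) (hyb.trans hbm) ?_ a ?_
    · rcases hy with ⟨h | h, -⟩ | ⟨h, -⟩ | ⟨h, -⟩
      exacts [h.1.ge, h.le, h.1.ge, h.le]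
    · tauto
  rcases hb.eq_or_lt with hfix | hleft
  · replace hfix := hfix.symm
    intro a ha
    have hab : (a : ℕ) = c.wNat b := by simpa [hfix] using ha
    have hrow := hv b
    rw [if_neg hbk.ne, Finset.sum_eq_single a, hM.1 b a hfix hab, mul_one] at hrow
    · exact hrow
    · intro a' _ hne
      obtain ⟨y, hy⟩ := c.exists_pivot a'
      rcases lt_trichotomy y b with h | h | h
      · rw [hsmall hy h, zero_mul]
      · subst h
        rw [hfix] at hy
        exact absurd (Fin.ext (by omega)) hne
      · rw [hM.eq_zero_of_lt_pivot hy h, mul_zero]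
    · simp
  · have hmate : c.mate b ≠ k := by
      rintro rfl
      rw [c.mate_invol] at hbm
      exact hbm.false
    have hL : c.wNat b < p := wNat_lt_of_isPlus_or_isLeft (Or.inr hleft)
    have hR := wNat_mate_eq_of_isLeft hleft
    obtain ⟨l, hl⟩ : ∃ l : Fin (p + q), (l : ℕ) = c.wNat b := ⟨⟨_, hL.trans_le (p.le_add_right q)⟩, rfl⟩
    obtain ⟨r, hr⟩ : ∃ r : Fin (p + q), (r : ℕ) = c.wNat (c.mate b) := ⟨⟨_, wNat_mate_lt_of_isLeft hleft⟩, rfl⟩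
    have hlr : l ≠ r := fun h => by
      have := congrArg Fin.val h
      omega
    have hrow := hv b
    have hrow' := hv (c.mate b)
    have hpivot : ∀ {a' y : Fin (p + q)}, a' ≠ l ∧ a' ≠ r →
        (((c.IsPlus y ∨ c.IsLeft y) ∧ (a' : ℕ) = c.wNat y) ∨
        (c.IsMinus y ∧ (a' : ℕ) = c.wNat y) ∨
        (c.IsLeft y ∧ (a' : ℕ) = c.wNat (c.mate y))) → y ≠ b := by
      rintro a' y ⟨h₁, h₂⟩ hy rfl
      have h₁ := Fin.val_ne_of_ne h₁
      have h₂ := Fin.val_ne_of_ne h₂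
      omega
    rw [if_neg hbk.ne, Fintype.sum_eq_add l r hlr, hM.2.1 b _ l ⟨hleft, rfl⟩ (Or.inl hl),
      hM.2.1 b _ r ⟨hleft, rfl⟩ (Or.inr hr)] at hrow
    · rw [if_neg hmate, Fintype.sum_eq_add l r hlr, hM.2.2.1 b _ l ⟨hleft, rfl⟩ hl,
        hM.2.2.2.1 b _ r ⟨hleft, rfl⟩ hr] at hrow'
      · intro a ha
        rcases ha with ha | ha
        · obtain rfl : a = l := Fin.ext (by omega)
          linear_combination (hrow - hrow') / 2
        · obtain rfl : a = r := Fin.ext (by omega)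
          linear_combination (hrow + hrow') / 2
      · intro a' hne
        obtain ⟨y, hy⟩ := c.exists_pivot a'
        rcases (hpivot hne hy).lt_or_gt with h | h
        · rw [hsmall hy h, zero_mul]
        · rw [hM.mate_eq_zero_of_lt_pivot hleft hy h, mul_zero]
    · intro a' hne
      obtain ⟨y, hy⟩ := c.exists_pivot a'
      rcases (hpivot hne hy).lt_or_gt with h | h
      · rw [hsmall hy h, zero_mul]
      · rw [hM.eq_zero_of_lt_pivot hy h, mul_zero]

lemma MemS.lam_eq_zero (hM : MemS c M) {lam : Fin (p + q) → Fin (p + q) → ℂ}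
    (hlam : LambdaRel p q M lam) {k : Fin (p + q)} (hbk : b < k) (hbm : b < c.mate k)
    (ha : (a : ℕ) = c.wNat b ∨ (a : ℕ) = c.wNat (c.mate b)) : lam k a = 0 := by
  have hv : ∀ x, ∑ a : Fin (p + q), (if (a : ℕ) < p then lam k a else -lam k a) * M x a
      = if x = k then 1 else 0 := by
    intro x
    have h := hlam k x
    rw [Finset.sum_filter, Finset.sum_filter, ← eq_sub_iff_add_eq, ← Finset.sum_sub_distrib] at h
    rw [h]
    refine Finset.sum_congr rfl fun a _ => ?_
    by_cases h : (a : ℕ) < p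
    · simp [h, h.not_ge]
    · simp [h, not_lt.1 h]
  have hzero : (if (a : ℕ) < p then lam k a else -lam k a) = 0 := by
    rcases le_total b (c.mate b) with h | h
    · exact hM.coeff_eq_zero hv b hbk hbm h a ha
    · refine hM.coeff_eq_zero hv (c.mate b) (h.trans_lt hbk) (h.trans_lt hbm) ?_ a ?_
      · rwa [c.mate_invol]
      · rwa [c.mate_invol, or_comm]
  split_ifs at hzero
  · exact hzero
  · exact neg_eq_zero.1 hzero

end Clan

/-- vanishing of the `λ`-coordinates at columns coming from earlier
positions. -/
theorem lambda_vanish_early {p q : ℕ} (β : Clan p q)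
    (M : Matrix (Fin (p + q)) (Fin (p + q)) ℂ) (hM : Clan.MemS β M)
    (lam : Fin (p + q) → Fin (p + q) → ℂ) (hlam : Clan.LambdaRel p q M lam) :
    (∀ k b : Fin (p + q), (β.IsPlus k ∨ β.IsMinus k ∨ β.IsLeft k) → b < k →
      ∀ a : Fin (p + q), ((a : ℕ) = β.wNat b ∨ (a : ℕ) = β.wNat (β.mate b)) →
        lam k a = 0) ∧
    (∀ k b : Fin (p + q), β.IsRight k → b < β.mate k →
      ∀ a : Fin (p + q), ((a : ℕ) = β.wNat b ∨ (a : ℕ) = β.wNat (β.mate b)) →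
        lam k a = 0) := by
  refine ⟨fun k b hk hbk a ha => hM.lam_eq_zero hlam hbk ?_ ha,
    fun k b hk hb a ha => hM.lam_eq_zero hlam (hb.trans hk) hb ha⟩
  rcases hk with h | h | h
  exacts [hbk.trans_eq h.1.symm, hbk.trans_eq h.1.symm, hbk.trans h]
end
end

section
/- Let β be a (p,q)-clan, M ∈ S_β, w = w_β, and let λ_{k,a} be the coordinates determined by M as in the context. If (k<k') is a matching of β, then λ_{k,a} = λ_{k',a} = 0 for all a with 1 ≤ a < w(k) and for all a with p+1 ≤ a < w(k'). -/
noncomputable section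
open scoped Classical

/-- The number of indices strictly below `i` that satisfy `P`. -/
def rankBelow {n : ℕ} (P : Fin n → Prop) (i : Fin n) : ℕ :=
  (Finset.univ.filter fun j => P j ∧ j < i).card

theorem rankBelow_mono {n : ℕ} (P : Fin n → Prop) : Monotone (rankBelow P) := by
  intro i j hij
  apply Finset.card_le_card
  intro x hx
  simp only [Finset.mem_filter, Finset.mem_univ, true_and] at hx ⊢
  exact ⟨hx.1, hx.2.trans_le hij⟩

theorem rankBelow_lt {n : ℕ} {P : Fin n → Prop} {i j : Fin n} (hi : P i) (hij : i < j) :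
    rankBelow P i < rankBelow P j := by
  apply Finset.card_lt_card
  rw [Finset.ssubset_iff_of_subset]
  · exact ⟨i, by simp [hi, hij], by simp⟩
  · intro x hx
    simp only [Finset.mem_filter, Finset.mem_univ, true_and] at hx ⊢
    exact ⟨hx.1, hx.2.trans hij⟩

theorem rankBelow_lt_card {n : ℕ} {P : Fin n → Prop} {i : Fin n} (hi : P i) :
    rankBelow P i < (Finset.univ.filter P).card := by
  apply Finset.card_lt_card
  rw [Finset.ssubset_iff_of_subset]
  · exact ⟨i, by simp [hi], by simp⟩
  · intro x hx
    simp only [Finset.mem_filter, Finset.mem_univ, true_and] at hx ⊢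
    exact hx.1

theorem exists_rankBelow_eq {n : ℕ} {P : Fin n → Prop} {m : ℕ}
    (hm : m < (Finset.univ.filter P).card) : ∃ i, P i ∧ rankBelow P i = m := by
  have hinj : Set.InjOn (rankBelow P) (Finset.univ.filter P) := by
    intro i hi j hj hij
    simp only [Finset.coe_filter, Finset.mem_univ, true_and, Set.mem_ofPred_eq] at hi hj
    rcases lt_trichotomy i j with h | h | h
    · exact absurd hij (rankBelow_lt hi h).ne
    · exact h
    · exact absurd hij (rankBelow_lt hj h).ne'
  have hmaps : Set.MapsTo (rankBelow P) (Finset.univ.filter P)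
      (Finset.range (Finset.univ.filter P).card) := by
    intro i hi
    simp only [Finset.coe_filter, Finset.mem_univ, true_and, Set.mem_ofPred_eq] at hi
    simpa using rankBelow_lt_card hi
  obtain ⟨i, hi, hi'⟩ := Finset.surjOn_of_injOn_of_card_le _ hmaps hinj (by simp)
    (Finset.mem_coe.2 (Finset.mem_range.2 hm))
  exact ⟨i, by simpa using hi, hi'⟩

namespace Clan

variable {p q : ℕ} (c : Clan p q)

/-- Row `i` contains the pivot of one of the first `p` columns. -/
def PosPivot (i : Fin (p + q)) : Prop := c.IsPlus i ∨ c.IsLeft i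

/-- Row `i` contains the pivot of one of the last `q` columns. -/
def NegPivot (i : Fin (p + q)) : Prop := c.IsMinus i ∨ c.IsLeft i

theorem card_posPivot_and_negPivot :
    (Finset.univ.filter c.PosPivot).card = p ∧ (Finset.univ.filter c.NegPivot).card = q := by
  have hpos : (Finset.univ.filter c.PosPivot).card =
      (Finset.univ.filter c.IsPlus).card + (Finset.univ.filter c.IsLeft).card := by
    rw [← Finset.card_union_of_disjoint]
    · congr 1
      ext i
      simp [PosPivot]
    · rw [Finset.disjoint_filter]
      intro i _ h h'
      exact absurd h.1 h'.ne'
  have hneg : (Finset.univ.filter c.NegPivot).card =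
      (Finset.univ.filter c.IsMinus).card + (Finset.univ.filter c.IsLeft).card := by
    rw [← Finset.card_union_of_disjoint]
    · congr 1
      ext i
      simp [NegPivot]
    · rw [Finset.disjoint_filter]
      intro i _ h h'
      exact absurd h.1 h'.ne'
  have hright : (Finset.univ.filter c.IsRight).card = (Finset.univ.filter c.IsLeft).card := by
    apply Finset.card_bij' (fun i _ => c.mate i) (fun i _ => c.mate i) <;>
      simp [IsLeft, IsRight, c.mate_invol]
  have htotal : (Finset.univ.filter c.PosPivot).card + ((Finset.univ.filter c.IsMinus).card +
      (Finset.univ.filter c.IsRight).card) = p + q := by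
    have hcompl : (Finset.univ.filter fun i => ¬ c.PosPivot i).card =
        (Finset.univ.filter c.IsMinus).card + (Finset.univ.filter c.IsRight).card := by
      rw [← Finset.card_union_of_disjoint]
      · congr 1
        ext i
        simp only [Finset.mem_union, Finset.mem_filter, Finset.mem_univ, true_and, PosPivot, IsPlus, IsLeft,
          IsMinus, IsRight]
        rcases lt_trichotomy (c.mate i) i with h | h | h
        · simp [h, h.ne, h.le]
        · simp [h]
        · simp [h.ne', h.not_ge, h.asymm]
      · rw [Finset.disjoint_filter]
        intro i _ h h'
        exact absurd h.1 h'.ne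
    rw [← hcompl, Finset.card_filter_add_card_filter_not]
    simp
  have hsign : (Finset.univ.filter c.IsPlus).card + q =
      (Finset.univ.filter c.IsMinus).card + p := by
    convert c.plus_minus <;> rfl
  omega

variable {c}

theorem wNat_of_posPivot {i : Fin (p + q)} (h : c.PosPivot i) :
    c.wNat i = rankBelow c.PosPivot i := by
  unfold wNat
  rw [if_pos (show c.IsPlus i ∨ c.IsLeft i from h)]
  unfold rankBelow PosPivot
  congr

theorem wNat_of_isMinus {i : Fin (p + q)} (h : c.IsMinus i) :
    c.wNat i = p + rankBelow c.NegPivot i := by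
  have h' : ¬ (c.IsPlus i ∨ c.IsLeft i) := by
    simp [IsPlus, IsLeft, h.1, h.2]
  unfold wNat
  rw [if_neg h', if_pos h]
  unfold rankBelow NegPivot
  congr

theorem wNat_mate_of_isLeft {i : Fin (p + q)} (h : c.IsLeft i) :
    c.wNat (c.mate i) = p + rankBelow c.NegPivot i := by
  have h₁ : ¬ (c.IsPlus (c.mate i) ∨ c.IsLeft (c.mate i)) := by
    simp only [IsPlus, IsLeft, c.mate_invol]
    rintro (h' | h')
    · exact h.ne h'.1
    · exact lt_asymm h h'
  have h₂ : ¬ c.IsMinus (c.mate i) := by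
    intro h'
    exact h.ne ((c.mate_invol i).symm.trans h'.1)
  unfold wNat
  rw [if_neg h₁, if_neg h₂, c.mate_invol]
  unfold rankBelow NegPivot
  congr

theorem exists_posPivot {a : Fin (p + q)} (ha : (a : ℕ) < p) :
    ∃ i, c.PosPivot i ∧ (a : ℕ) = rankBelow c.PosPivot i := by
  obtain ⟨i, hi, h⟩ := exists_rankBelow_eq (P := c.PosPivot)
    (ha.trans_eq c.card_posPivot_and_negPivot.1.symm)
  exact ⟨i, hi, h.symm⟩

theorem exists_negPivot {a : Fin (p + q)} (ha : p ≤ (a : ℕ)) :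
    ∃ i, c.NegPivot i ∧ (a : ℕ) = p + rankBelow c.NegPivot i := by
  obtain ⟨i, hi, h⟩ := exists_rankBelow_eq (P := c.NegPivot) (m := (a : ℕ) - p) (by
    rw [c.card_posPivot_and_negPivot.2]
    omega)
  exact ⟨i, hi, by omega⟩

theorem rankBelow_posPivot_lt {i : Fin (p + q)} (h : c.PosPivot i) :
    rankBelow c.PosPivot i < p :=
  (rankBelow_lt_card h).trans_eq c.card_posPivot_and_negPivot.1

theorem rankBelow_negPivot_lt {i : Fin (p + q)} (h : c.NegPivot i) :
    rankBelow c.NegPivot i < q :=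
  (rankBelow_lt_card h).trans_eq c.card_posPivot_and_negPivot.2

/-- A solution `f` of the rows of `∑_{a ≥ p} f a • v_a = ∑_{a < p} f a • v_a` indexed by positions
`x < k` and their mates vanishes at every column whose pivot lies above row `k`. -/
theorem MemS.eq_zero_of_pivot_lt {M : Matrix (Fin (p + q)) (Fin (p + q)) ℂ} (hM : MemS c M)
    {f : Fin (p + q) → ℂ} {k : Fin (p + q)}
    (hf : ∀ x, (x < k ∨ c.mate x < k) →
      ∑ a ∈ Finset.univ.filter (fun a : Fin (p + q) => p ≤ (a : ℕ)), f a * M x a =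
        ∑ a ∈ Finset.univ.filter (fun a : Fin (p + q) => (a : ℕ) < p), f a * M x a)
    (x : Fin (p + q)) (hx : x < k) :
    (∀ a : Fin (p + q), c.PosPivot x → (a : ℕ) = rankBelow c.PosPivot x → f a = 0) ∧
    (∀ a : Fin (p + q), c.NegPivot x → (a : ℕ) = p + rankBelow c.NegPivot x → f a = 0) := by
  obtain ⟨o1, o2, o3, o3', z1, z2, -, z4, z5, z5', z6, z6', -, z8, -⟩ := hM
  induction x using WellFoundedLT.induction with
  | _ x ih =>
  have hpos_above : ∀ y a : Fin (p + q), c.PosPivot y → (a : ℕ) = rankBelow c.PosPivot y →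
      x < y → M x a = 0 := fun y a hy ha hxy =>
    z2 y x a hy (ha.trans (wNat_of_posPivot hy).symm) hxy
  have hneg_above : ∀ y a : Fin (p + q), c.NegPivot y → (a : ℕ) = p + rankBelow c.NegPivot y →
      x < y → M x a = 0 := by
    rintro y a (hy | hy) ha hxy
    · exact z6 y x a hy (ha.trans (wNat_of_isMinus hy).symm) hxy
    · exact z6' y _ x a ⟨hy, rfl⟩ (ha.trans (wNat_mate_of_isLeft hy).symm) hxy
  rcases lt_trichotomy x (c.mate x) with hlt | heq | hgt
  · have hP : c.PosPivot x := Or.inr hlt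
    have hN : c.NegPivot x := Or.inr hlt
    have hwP := wNat_of_posPivot hP
    have hwN := wNat_mate_of_isLeft hlt
    have hm : c.IsMatch x (c.mate x) := ⟨hlt, rfl⟩
    have hrP := rankBelow_posPivot_lt hP
    have hrN := rankBelow_negPivot_lt hN
    obtain ⟨u, hu⟩ : ∃ u : Fin (p + q), (u : ℕ) = rankBelow c.PosPivot x :=
      ⟨⟨rankBelow c.PosPivot x, by omega⟩, rfl⟩
    obtain ⟨v, hv⟩ : ∃ v : Fin (p + q), (v : ℕ) = p + rankBelow c.NegPivot x :=
      ⟨⟨p + rankBelow c.NegPivot x, by omega⟩, rfl⟩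
    have htop := hf x (Or.inl hx)
    have hbot := hf (c.mate x) (Or.inr (by rwa [c.mate_invol]))
    rw [Finset.sum_eq_single v, Finset.sum_eq_single u,
      o2 x _ v hm (Or.inr (hv.trans hwN.symm)), o2 x _ u hm (Or.inl (hu.trans hwP.symm))] at htop
    rotate_left
    · intro a ha hau
      rw [z1 x a hP (Finset.mem_filter.1 ha).2 (fun h => hau (Fin.ext (by omega))), mul_zero]
    · intro h
      simp only [Finset.mem_filter, Finset.mem_univ, true_and] at h
      omega
    · intro a ha hav
      rw [z5' x _ a hm (Finset.mem_filter.1 ha).2 (fun h => hav (Fin.ext (by omega))), mul_zero]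
    · intro h
      simp only [Finset.mem_filter, Finset.mem_univ, true_and] at h
      omega
    rw [Finset.sum_eq_single v, Finset.sum_eq_single u,
      o3' x _ v hm (hv.trans hwN.symm), o3 x _ u hm (hu.trans hwP.symm)] at hbot
    rotate_left
    · intro a ha hau
      have ha' := (Finset.mem_filter.1 ha).2
      obtain ⟨y, hy, hay⟩ := exists_posPivot (c := c) ha'
      rcases lt_trichotomy y x with h | rfl | h
      · rw [(ih y h (h.trans hx)).1 a hy hay, zero_mul]
      · exact absurd (Fin.ext (hay.trans hu.symm)) hau
      · rw [z4 x _ a hm (by have := rankBelow_lt hP h; omega) ha', mul_zero]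
    · intro h
      simp only [Finset.mem_filter, Finset.mem_univ, true_and] at h
      omega
    · intro a ha hav
      have ha' := (Finset.mem_filter.1 ha).2
      obtain ⟨y, hy, hay⟩ := exists_negPivot (c := c) ha'
      rcases lt_trichotomy y x with h | rfl | h
      · rw [(ih y h (h.trans hx)).2 a hy hay, zero_mul]
      · exact absurd (Fin.ext (hay.trans hv.symm)) hav
      · rw [z8 x _ a hm (by have := rankBelow_lt hN h; omega), mul_zero]
    · intro h
      simp only [Finset.mem_filter, Finset.mem_univ, true_and] at h
      omega
    have hfv : f v = 0 := by linear_combination (htop + hbot) / 2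
    have hfu : f u = 0 := by linear_combination hfv - htop
    refine ⟨fun a _ ha => ?_, fun a _ ha => ?_⟩
    · rwa [show a = u from Fin.ext (ha.trans hu.symm)]
    · rwa [show a = v from Fin.ext (ha.trans hv.symm)]
  · have hnl : ¬ c.IsLeft x := heq.not_lt
    have hrow := hf x (Or.inl hx)
    cases hs : c.sign x with
    | true =>
      have hN : ¬ c.NegPivot x := by
        rintro (h | h)
        · simp [h.2] at hs
        · exact hnl h
      refine ⟨fun a hP ha => ?_, fun a h => absurd h hN⟩
      have hwP := wNat_of_posPivot hP
      have hrP := rankBelow_posPivot_lt hP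
      rw [Finset.sum_eq_zero, Finset.sum_eq_single a, o1 x a heq.symm (ha.trans hwP.symm)]
        at hrow
      · simpa using hrow.symm
      · intro b hb hba
        rw [z1 x b hP (Finset.mem_filter.1 hb).2 (fun h => hba (Fin.ext (by omega))), mul_zero]
      · intro h
        simp only [Finset.mem_filter, Finset.mem_univ, true_and] at h
        omega
      · intro b hb
        obtain ⟨y, hy, hby⟩ := exists_negPivot (c := c) (Finset.mem_filter.1 hb).2
        rcases lt_trichotomy y x with h | rfl | h
        · rw [(ih y h (h.trans hx)).2 b hy hby, zero_mul]
        · exact absurd hy hN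
        · rw [hneg_above y b hy hby h, mul_zero]
    | false =>
      have hP : ¬ c.PosPivot x := by
        rintro (h | h)
        · simp [h.2] at hs
        · exact hnl h
      have hmin : c.IsMinus x := ⟨heq.symm, hs⟩
      refine ⟨fun a h => absurd h hP, fun a _ ha => ?_⟩
      have hwN := wNat_of_isMinus hmin
      rw [Finset.sum_eq_single a, Finset.sum_eq_zero, o1 x a heq.symm (ha.trans hwN.symm)]
        at hrow
      · simpa using hrow
      · intro b hb
        obtain ⟨y, hy, hby⟩ := exists_posPivot (c := c) (Finset.mem_filter.1 hb).2
        rcases lt_trichotomy y x with h | rfl | h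
        · rw [(ih y h (h.trans hx)).1 b hy hby, zero_mul]
        · exact absurd hy hP
        · rw [hpos_above y b hy hby h, mul_zero]
      · intro b hb hba
        rw [z5 x b hmin (Finset.mem_filter.1 hb).2 (fun h => hba (Fin.ext (by omega))), mul_zero]
      · intro h
        simp only [Finset.mem_filter, Finset.mem_univ, true_and] at h
        omega
  · refine ⟨fun a h => ?_, fun a h => ?_⟩
    · rcases h with h | h
      · exact absurd h.1 hgt.ne
      · exact absurd h hgt.asymm
    · rcases h with h | h
      · exact absurd h.1 hgt.ne
      · exact absurd h hgt.asymm

end Clan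

/-- for a matching `(k<k')` of `β`, the `λ`-coordinates of rows `k` and `k'`
vanish in all columns before `w(k)` and all columns in `[p, w(k'))`. -/
theorem lambda_vanish_matching {p q : ℕ} (β : Clan p q)
    (M : Matrix (Fin (p + q)) (Fin (p + q)) ℂ) (hM : Clan.MemS β M)
    (lam : Fin (p + q) → Fin (p + q) → ℂ) (hlam : Clan.LambdaRel p q M lam)
    (k k' : Fin (p + q)) (h : β.IsMatch k k') :
    ∀ a : Fin (p + q),
      ((a : ℕ) < β.wNat k ∨ (p ≤ (a : ℕ) ∧ (a : ℕ) < β.wNat k')) →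
      lam k a = 0 ∧ lam k' a = 0 := by
  intro a ha
  obtain ⟨hlt, rfl⟩ := h
  have hP : β.PosPivot k := Or.inr hlt
  have hwP := Clan.wNat_of_posPivot hP
  have hwN := Clan.wNat_mate_of_isLeft hlt
  have hrP := Clan.rankBelow_posPivot_lt hP
  have key : ∀ K, k ≤ K → k ≤ β.mate K → lam K a = 0 := by
    intro K hK hK'
    have hvanish := hM.eq_zero_of_pivot_lt (f := lam K) (k := k) (by
      intro x hx
      have hxK : x ≠ K := by
        rintro rfl
        rcases hx with hx | hx
        · exact hx.not_ge hK
        · exact hx.not_ge hK'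
      simpa [hxK] using hlam K x)
    rcases lt_or_ge (a : ℕ) p with hap | hap
    · obtain ⟨y, hy, hay⟩ := Clan.exists_posPivot (c := β) hap
      have hyk : y < k := (rankBelow_mono β.PosPivot).reflect_lt (by omega)
      exact (hvanish y hyk).1 a hy hay
    · obtain ⟨y, hy, hay⟩ := Clan.exists_negPivot (c := β) hap
      have hyk : y < k := (rankBelow_mono β.NegPivot).reflect_lt (by omega)
      exact (hvanish y hyk).2 a hy hay
  exact ⟨key k le_rfl hlt.le, key (β.mate k) hlt.le (β.mate_invol k).ge⟩
end
end
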